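/- Let d be a prime and let c_0 ∈ ℂ be a root of the Gleason polynomial G_{d,n} for some n ≥ 1. Set K = ℚ(c_0). If α ∈ K satisfies v_𝔭(α) = 1 for some prime ideal 𝔭 ⊂ O_K lying above d, then the pair (f_{d,c_0}, α) is stable over K, i.e., f_{d,c_0}^k − α is irreducible over K for every k ≥ 1. -/

import Mathlib

open Polynomial IntermediateField

noncomputable section

/-- The value sequence `a_i(c)`: `a_0 = 0`, `a_{i+1} = a_i ^ d + c`. -/
def aSeq (d : ℕ) {F : Type*} [CommRing F] (c : F) : ℕ → F
  | 0 => 0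
  | i + 1 => aSeq d c i ^ d + c

/-- The polynomials `a_i ∈ ℤ[c]`: `a_0 = 0`, `a_{i+1} = a_i ^ d + c`. -/
def aPoly (d : ℕ) : ℕ → Polynomial ℤ
  | 0 => 0
  | i + 1 => aPoly d i ^ d + X

/-- Iterates of `f_{d,c} = x^d + c`: `f^0 = x`, `f^{k+1} = f ∘ f^k`. -/
def fIter (d : ℕ) {F : Type*} [CommRing F] (c : F) : ℕ → Polynomial F
  | 0 => X
  | k + 1 => fIter d c k ^ d + C c

/-- `c₀` is a root of the Gleason polynomial `G_{d,n} = ∏_{k ∣ n} a_k^{μ(n/k)}`. -/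
def isGleasonRoot (d n : ℕ) (c₀ : ℂ) : Prop :=
  ∃ g : Polynomial ℤ,
    g * ∏ k ∈ n.divisors, aPoly d k ^ ((-(ArithmeticFunction.moebius (n / k))).toNat)
        = ∏ k ∈ n.divisors, aPoly d k ^ ((ArithmeticFunction.moebius (n / k)).toNat)
    ∧ Polynomial.aeval c₀ g = 0

/-- `c₀` is a root of the Misiurewicz polynomial `G_{d,m,n}^ζ`. -/
def isMisiurewiczRoot (d m n : ℕ) (ζ c₀ : ℂ) : Prop :=
  ∃ g : Polynomial ℂ,
    g * ((∏ k ∈ n.divisors,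
            ((aPoly d (m + k - 1)).map (Int.castRingHom ℂ) -
              C ζ * (aPoly d (m - 1)).map (Int.castRingHom ℂ))
                ^ ((-(ArithmeticFunction.moebius (n / k))).toNat)) *
          (if n ∣ (m - 1) then
            ∏ k ∈ n.divisors, ((aPoly d k).map (Int.castRingHom ℂ))
                ^ ((ArithmeticFunction.moebius (n / k)).toNat)
          else 1))
        = (∏ k ∈ n.divisors,
            ((aPoly d (m + k - 1)).map (Int.castRingHom ℂ) -
              C ζ * (aPoly d (m - 1)).map (Int.castRingHom ℂ))
                ^ ((ArithmeticFunction.moebius (n / k)).toNat)) *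
          (if n ∣ (m - 1) then
            ∏ k ∈ n.divisors, ((aPoly d k).map (Int.castRingHom ℂ))
                ^ ((-(ArithmeticFunction.moebius (n / k))).toNat)
          else 1)
    ∧ g.eval c₀ = 0

/-- The polynomial `F_{k,i}^{(d,c₀)} = ∏_{j=1}^{d-1} (f_{d,c₀}^k - ζ^j a_i(c₀))` over `ℂ`. -/
def FPoly (d : ℕ) (c₀ ζ : ℂ) (k i : ℕ) : Polynomial ℂ :=
  ∏ j ∈ Finset.Icc 1 (d - 1), (fIter d c₀ k - C (ζ ^ j * aSeq d c₀ i))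


section Iterates

variable {R S : Type*} [CommRing R] [CommRing S]

lemma map_aSeq (d : ℕ) (φ : R →+* S) (c : R) (k : ℕ) :
    φ (aSeq d c k) = aSeq d (φ c) k := by
  induction k with
  | zero => simp [aSeq]
  | succ k ih => simp [aSeq, ih]

lemma aeval_aPoly (d : ℕ) (c : R) (k : ℕ) : aeval c (aPoly d k) = aSeq d c k := by
  induction k with
  | zero => simp [aPoly, aSeq]
  | succ k ih => simp [aPoly, aSeq, ih]

lemma aSeq_add_of_eq_zero {d : ℕ} {c : R} {m : ℕ} (hm : aSeq d c m = 0) (k : ℕ) :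
    aSeq d c (k + m) = aSeq d c k := by
  induction k with
  | zero => simpa [aSeq] using hm
  | succ k ih => rw [Nat.succ_add, aSeq, ih, aSeq]

lemma aSeq_mul_of_eq_zero {d : ℕ} {c : R} {m : ℕ} (hm : aSeq d c m = 0) (k : ℕ) :
    aSeq d c (k * m) = 0 := by
  induction k with
  | zero => simp [aSeq]
  | succ k ih => rw [Nat.succ_mul, aSeq_add_of_eq_zero hm, ih]

lemma map_fIter (d : ℕ) (φ : R →+* S) (c : R) (k : ℕ) :
    (fIter d c k).map φ = fIter d (φ c) k := by
  induction k with
  | zero => simp [fIter]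
  | succ k ih => simp [fIter, ih]

lemma eval_zero_fIter (d : ℕ) (c : R) (k : ℕ) : (fIter d c k).eval 0 = aSeq d c k := by
  induction k with
  | zero => simp [fIter, aSeq]
  | succ k ih => simp [fIter, aSeq, ih]

lemma fIter_add (d : ℕ) (c : R) (k m : ℕ) :
    fIter d c (k + m) = (fIter d c k).comp (fIter d c m) := by
  induction k with
  | zero => simp [fIter]
  | succ k ih => simp [Nat.succ_add, fIter, ih]

lemma monic_fIter_and_natDegree [Nontrivial R] {d : ℕ} (hd : d ≠ 0) (c : R) (k : ℕ) :
    (fIter d c k).Monic ∧ (fIter d c k).natDegree = d ^ k := by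
  induction k with
  | zero => simp [fIter, monic_X]
  | succ k ih =>
    have hdeg : (fIter d c k ^ d).natDegree = d ^ (k + 1) := by
      rw [ih.1.natDegree_pow, ih.2, pow_succ']
    refine ⟨(ih.1.pow d).add_of_left (degree_C_le.trans_lt ?_), ?_⟩
    · exact natDegree_pos_iff_degree_pos.1 (hdeg ▸ by positivity)
    · rw [fIter, natDegree_add_C, hdeg]

lemma monic_aPoly_and_natDegree {d : ℕ} (hd : 2 ≤ d) (k : ℕ) :
    (aPoly d (k + 1)).Monic ∧ (aPoly d (k + 1)).natDegree = d ^ k := by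
  induction k with
  | zero => simp [aPoly, zero_pow (show d ≠ 0 by omega), monic_X]
  | succ k ih =>
    have hdeg : (aPoly d (k + 1) ^ d).natDegree = d ^ (k + 1) := by
      rw [ih.1.natDegree_pow, ih.2, pow_succ']
    have hlt : (X : ℤ[X]).natDegree < (aPoly d (k + 1) ^ d).natDegree := by
      rw [hdeg, natDegree_X]
      exact Nat.one_lt_pow (by omega) (by omega)
    refine ⟨(ih.1.pow d).add_of_left (degree_lt_degree hlt), ?_⟩
    rw [aPoly, natDegree_add_eq_left_of_natDegree_lt hlt, hdeg]

lemma fIter_eq_of_charP (d : ℕ) [Fact d.Prime] [CharP R d] (c : R) (k : ℕ) :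
    fIter d c k = X ^ d ^ k + C (aSeq d c k) := by
  induction k with
  | zero => simp [fIter, aSeq]
  | succ k ih =>
    rw [fIter, ih, add_pow_char, aSeq, ← pow_mul, ← pow_succ, C_add, C_pow, add_assoc]

lemma coeff_fIter_mem {d : ℕ} (hd : d.Prime) {P : Ideal R} (hP : P ≠ ⊤) (hdP : (d : R) ∈ P)
    {c : R} {k : ℕ} (hk : aSeq d c k = 0) {i : ℕ} (hi : i < d ^ k) :
    (fIter d c k).coeff i ∈ P := by
  have := Fact.mk hd
  have : Nontrivial (R ⧸ P) := Ideal.Quotient.nontrivial_iff.2 hP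
  have h0 : (d : R ⧸ P) = 0 := by
    simpa using Ideal.Quotient.eq_zero_iff_mem.2 hdP
  have : CharP (R ⧸ P) d := by
    rw [← CharP.ringChar_of_prime_eq_zero hd h0]
    infer_instance
  rw [← Ideal.Quotient.eq_zero_iff_mem, ← coeff_map, map_fIter, fIter_eq_of_charP d,
    ← map_aSeq, hk, map_zero, C_0, add_zero, coeff_X_pow, if_neg hi.ne]

end Iterates

lemma irreducible_of_scaleRoots {K : Type*} [Field K] {p : K[X]} (s : K)
    (h : Irreducible (p.scaleRoots s)) : Irreducible p := by
  have hunit (q : K[X]) : IsUnit (q.scaleRoots s) ↔ IsUnit q := by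
    simp only [isUnit_iff_degree_eq_zero, degree_scaleRoots]
  refine ⟨fun hp => h.not_isUnit ((hunit p).2 hp), fun a b hab => ?_⟩
  rw [← hunit a, ← hunit b]
  exact h.isUnit_or_isUnit (by rw [hab, mul_scaleRoots_of_noZeroDivisors])

lemma irreducible_of_irreducible_comp {K : Type*} [Field K] {p q : K[X]}
    (hq : 0 < q.natDegree) (h : Irreducible (p.comp q)) : Irreducible p := by
  have hunit (r : K[X]) : IsUnit (r.comp q) ↔ IsUnit r := by
    simp only [Polynomial.isUnit_iff]
    refine ⟨fun ⟨u, hu, hr⟩ => ?_, fun ⟨u, hu, hr⟩ => ⟨u, hu, by rw [← hr, C_comp]⟩⟩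
    have hdeg : r.natDegree = 0 := by
      have := natDegree_comp (p := r) (q := q)
      rw [← hr, natDegree_C, eq_comm, mul_eq_zero] at this
      omega
    obtain ⟨v, rfl⟩ := natDegree_eq_zero.1 hdeg
    rw [C_comp] at hr
    exact ⟨u, hu, hr⟩
  refine ⟨fun hp => h.not_isUnit ((hunit p).2 hp), fun a b hab => ?_⟩
  rw [← hunit a, ← hunit b]
  exact h.isUnit_or_isUnit (by rw [hab, mul_comp])

lemma mul_notMem_sq_of_isMaximal {R : Type*} [CommRing R] {P : Ideal R} (hP : P.IsMaximal)
    {a b : R} (haP : a ∈ P) (ha : a ∉ P ^ 2) (hb : b ∉ P) : a * b ∉ P ^ 2 := by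
  intro hab
  obtain ⟨y, p, hp, h⟩ := hP.exists_inv hb
  refine ha ?_
  have : a = y * (a * b) + a * p := by linear_combination -a * h
  rw [this]
  exact add_mem (Ideal.mul_mem_left _ _ hab) (pow_two P ▸ Ideal.mul_mem_mul haP hp)

/-- An Eisenstein-type criterion for `F - α` with `α = a / b` only assumed `P`-integral. -/
lemma irreducible_map_sub_C_of_eisenstein {R K : Type*} [CommRing R] [IsDomain R]
    [IsIntegrallyClosed R] [Field K] [Algebra R K] [IsFractionRing R K] {P : Ideal R}
    (hP : P.IsMaximal) {F : R[X]} (hF : F.Monic) (hdeg : 0 < F.natDegree)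
    (hmem : ∀ i < F.natDegree, F.coeff i ∈ P) (h0 : F.coeff 0 ∈ P ^ 2)
    {α : K} {a b : R} (hb : b ∉ P) (hαb : α * algebraMap R K b = algebraMap R K a)
    (ha : a ∈ P) (ha2 : a ∉ P ^ 2) :
    Irreducible (F.map (algebraMap R K) - C α) := by
  have hbpow (j : ℕ) : b ^ j ∉ P := fun h => hb (hP.isPrime.mem_of_pow_mem j h)
  set Q : R[X] := F.scaleRoots b - C (a * b ^ (F.natDegree - 1)) with hQ
  have hFs : (F.scaleRoots b).Monic := (monic_scaleRoots_iff b).2 hF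
  have hQmonic : Q.Monic := by
    refine hFs.sub_of_left (degree_C_le.trans_lt ?_)
    rw [degree_scaleRoots]
    exact natDegree_pos_iff_degree_pos.1 hdeg
  have hQdeg : Q.natDegree = F.natDegree := by
    rw [hQ, natDegree_sub_C, natDegree_scaleRoots]
  have hcoeff0 : Q.coeff 0 = F.coeff 0 * b ^ F.natDegree - a * b ^ (F.natDegree - 1) := by
    rw [hQ, coeff_sub, coeff_scaleRoots, coeff_C_zero, Nat.sub_zero]
  have hQirr : Irreducible Q := by
    refine irreducible_of_eisenstein_criterion hP.isPrime
      (by rw [hQmonic.leadingCoeff]; exact (Ideal.ne_top_iff_one P).1 hP.ne_top)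
      (fun i hi => ?_) (natDegree_pos_iff_degree_pos.1 (hQdeg ▸ hdeg)) ?_ hQmonic.isPrimitive
    · have hi' : i < F.natDegree := hQdeg ▸ coe_lt_degree.1 hi
      rw [hQ, coeff_sub, coeff_scaleRoots, coeff_C]
      refine sub_mem (Ideal.mul_mem_right _ _ (hmem i hi')) ?_
      split_ifs
      · exact Ideal.mul_mem_right _ _ ha
      · exact zero_mem _
    · rw [hcoeff0]
      intro h
      refine mul_notMem_sq_of_isMaximal hP ha ha2 (hbpow (F.natDegree - 1)) ?_
      simpa using sub_mem (Ideal.mul_mem_right (b ^ F.natDegree) _ h0) h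
  rw [hQmonic.irreducible_iff_irreducible_map_fraction_map (K := K)] at hQirr
  refine irreducible_of_scaleRoots (algebraMap R K b) ?_
  convert hQirr using 1
  have hFK : (F.map (algebraMap R K)).natDegree = F.natDegree := hF.natDegree_map _
  ext i
  rw [coeff_scaleRoots, natDegree_sub_C, hFK, coeff_sub, coeff_map, coeff_map, hQ, coeff_sub,
    coeff_scaleRoots, coeff_C, coeff_C, map_sub, sub_mul]
  congr 1
  · simp
  · split_ifs with hi
    · subst hi
      rw [Nat.sub_zero, map_mul, ← hαb, map_pow, mul_assoc, ← pow_succ',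
        Nat.sub_add_cancel hdeg]
    · simp

lemma exists_aSeq_eq_zero_of_isGleasonRoot {d n : ℕ} {c₀ : ℂ} (h : isGleasonRoot d n c₀) :
    ∃ m, 0 < m ∧ aSeq d c₀ m = 0 := by
  obtain ⟨g, hg, hg0⟩ := h
  have := congrArg (aeval c₀) hg
  rw [map_mul, hg0, zero_mul, map_prod, eq_comm, Finset.prod_eq_zero_iff] at this
  obtain ⟨m, hm, hm0⟩ := this
  rw [map_pow] at hm0
  exact ⟨m, Nat.pos_of_mem_divisors hm, by rw [← aeval_aPoly]; exact eq_zero_of_pow_eq_zero hm0⟩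

lemma isIntegral_of_aSeq_eq_zero {R : Type*} [CommRing R] {d : ℕ} (hd : 2 ≤ d) {c : R} {m : ℕ}
    (hm : 0 < m) (h : aSeq d c m = 0) : IsIntegral ℤ c := by
  obtain ⟨k, rfl⟩ := Nat.exists_eq_succ_of_ne_zero hm.ne'
  exact ⟨aPoly d (k + 1), (monic_aPoly_and_natDegree hd k).1, by
    rw [← aeval_def, aeval_aPoly]; exact h⟩

/-- If `0` is periodic under `x ^ d + c`, then `f ^ k - α` is irreducible for every `α` with
valuation one at a maximal ideal above the prime `d`. -/
lemma irreducible_fIter_sub_C {R K : Type*} [CommRing R] [IsDomain R]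
    [IsIntegrallyClosed R] [Field K] [Algebra R K] [IsFractionRing R K] {d : ℕ} (hd : d.Prime)
    {P : Ideal R} (hP : P.IsMaximal) (hdP : (d : R) ∈ P) {c : R} {m : ℕ} (hm : 0 < m)
    (hc : aSeq d c m = 0) {α : K} {a b : R} (hb : b ∉ P)
    (hαb : α * algebraMap R K b = algebraMap R K a) (ha : a ∈ P) (ha2 : a ∉ P ^ 2) (k : ℕ) :
    Irreducible (fIter d (algebraMap R K c) k - C α) := by
  have hkm : aSeq d c (k * m) = 0 := aSeq_mul_of_eq_zero hc k
  obtain ⟨hmonic, hdeg⟩ := monic_fIter_and_natDegree hd.ne_zero c (k * m)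
  have hirr := irreducible_map_sub_C_of_eisenstein hP hmonic
    (hdeg ▸ pow_pos hd.pos _) (fun i hi => coeff_fIter_mem hd hP.ne_top hdP hkm (hdeg ▸ hi))
    (by rw [coeff_zero_eq_eval_zero, eval_zero_fIter, hkm]; exact zero_mem _) hb hαb ha ha2
  refine irreducible_of_irreducible_comp
    (q := fIter d (algebraMap R K c) (k * m - k)) ?_ ?_
  · rw [(monic_fIter_and_natDegree hd.ne_zero _ _).2]
    exact pow_pos hd.pos _
  · rwa [sub_comp, C_comp, ← fIter_add, Nat.add_sub_cancel' (Nat.le_mul_of_pos_right k hm),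
      ← map_fIter]

/-- If `c₀` is a Gleason parameter (root of `G_{d,n}`), `K = ℚ(c₀)`, and
`α ∈ K` has `v_𝔭(α) = 1` at some prime `𝔭` of `O_K` above `d`, then `(f_{d,c₀}, α)` is
stable over `K`: every iterate minus `α` is irreducible. -/
theorem stmt1 (d : ℕ) (hd : Nat.Prime d) (n : ℕ) (hn : 1 ≤ n)
    (c₀ : ℂ) (hc₀ : isGleasonRoot d n c₀)
    (α : ℚ⟮c₀⟯)
    (𝔭 : Ideal (integralClosure ℤ ℚ⟮c₀⟯)) (h𝔭 : 𝔭.IsPrime)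
    (h𝔭d : (d : integralClosure ℤ ℚ⟮c₀⟯) ∈ 𝔭)
    (hα : ∃ a b : integralClosure ℤ ℚ⟮c₀⟯, b ∉ 𝔭 ∧ α * b = a ∧ a ∈ 𝔭 ∧ a ∉ 𝔭 ^ 2) :
    ∀ k : ℕ, 1 ≤ k →
      Irreducible (fIter d (IntermediateField.AdjoinSimple.gen ℚ c₀) k - C α) := by
  intro k _
  obtain ⟨a, b, hb, hαb, ha, ha2⟩ := hα
  obtain ⟨m, hm, hm0⟩ := exists_aSeq_eq_zero_of_isGleasonRoot hc₀
  have hfin : FiniteDimensional ℚ ℚ⟮c₀⟯ :=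
    adjoin.finiteDimensional (isIntegral_of_aSeq_eq_zero hd.two_le hm hm0).tower_top
  have hgen : aSeq d (AdjoinSimple.gen ℚ c₀) m = 0 := by
    apply (algebraMap ℚ⟮c₀⟯ ℂ).injective
    rw [map_aSeq, AdjoinSimple.algebraMap_gen, hm0, map_zero]
  let c : integralClosure ℤ ℚ⟮c₀⟯ :=
    ⟨AdjoinSimple.gen ℚ c₀, isIntegral_of_aSeq_eq_zero hd.two_le hm hgen⟩
  have hc : aSeq d c m = 0 := by
    apply Subtype.val_injective
    exact (map_aSeq d (algebraMap (integralClosure ℤ ℚ⟮c₀⟯) ℚ⟮c₀⟯) c m).trans hgen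
  have : IsFractionRing (integralClosure ℤ ℚ⟮c₀⟯) ℚ⟮c₀⟯ :=
    integralClosure.isFractionRing_of_finite_extension ℚ ℚ⟮c₀⟯
  have : IsIntegrallyClosed (integralClosure ℤ ℚ⟮c₀⟯) :=
    integralClosure.isIntegrallyClosedOfFiniteExtension ℚ
  have hne : 𝔭 ≠ ⊥ := by
    rintro rfl
    exact hd.ne_zero (by exact_mod_cast (Ideal.mem_bot.1 h𝔭d))
  exact irreducible_fIter_sub_C hd (h𝔭.isMaximal hne) h𝔭d hm hc hb hαb ha ha2 k
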